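/- Let 0<q<1 and a,b ∈ ℝ with |a| + |b| < 1, and let x ≥ 0. Then \int_0^x e^{-t} R(a,b,q,t)\,dt = 1 + \sum_{n=1}^\infty \sum_{r=0}^{n} q^{r(r-1)/2} \binom{n}{r}_q a^{n-r} b^r \; - \; e^{-x}\left(1 + \sum_{n=1}^\infty \sum_{k=0}^{n} \sum_{r=0}^{n} q^{r(r-1)/2} \binom{n}{r}_q a^{n-r} b^r \frac{x^k}{k!}\right), where all series on the right-hand side converge. -/

import Mathlib

open Finset

/-- The Ramanujan function `R(a,b,q,x) = 1 + ∑_{n≥1} (xⁿ/n!) ∏_{j=0}^{n-1} (a + b qʲ)`,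
written as a single `tsum` (the `n = 0` term equals `1`). -/
noncomputable def ramanujanR (a b q x : ℝ) : ℝ :=
  ∑' n : ℕ, x ^ n / (Nat.factorial n : ℝ) * ∏ j ∈ Finset.range n, (a + b * q ^ j)

/-- The Gaussian binomial coefficient `(n r)_q`. -/
noncomputable def gaussBinom (q : ℝ) (n r : ℕ) : ℝ :=
  if r ≤ n then
    (∏ i ∈ Finset.range r, (1 - q ^ (n - i))) / ∏ i ∈ Finset.range r, (1 - q ^ (i + 1))
  else 0

theorem gaussBinom_zero_right (q : ℝ) (n : ℕ) : gaussBinom q n 0 = 1 := by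
  simp [gaussBinom]

theorem gaussBinom_of_lt (q : ℝ) {n r : ℕ} (h : n < r) : gaussBinom q n r = 0 := by
  simp [gaussBinom, h]

theorem gaussBinom_eq_div (q : ℝ) (n r : ℕ) :
    gaussBinom q n r =
      (∏ i ∈ range r, (1 - q ^ (n - i))) / ∏ i ∈ range r, (1 - q ^ (i + 1)) := by
  unfold gaussBinom
  split_ifs with h
  · rfl
  · rw [prod_eq_zero (mem_range.2 (not_le.1 h)) (by simp), zero_div]

/-- The `q`-Pascal rule. -/
theorem gaussBinom_succ_succ {q : ℝ} (hq0 : 0 ≤ q) (hq1 : q < 1) {n r : ℕ} (h : r ≤ n) :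
    gaussBinom q (n + 1) (r + 1) = gaussBinom q n (r + 1) + q ^ (n - r) * gaussBinom q n r := by
  have hne : ∀ i : ℕ, 1 - q ^ (i + 1) ≠ 0 := fun i =>
    (sub_pos.2 (pow_lt_one₀ hq0 hq1 i.succ_ne_zero)).ne'
  have hD : ∏ i ∈ range r, (1 - q ^ (i + 1)) ≠ 0 := prod_ne_zero_iff.2 fun i _ => hne i
  have hr := hne r
  have hpow : q ^ (n + 1) = q ^ (n - r) * q ^ (r + 1) := by
    rw [← pow_add]; congr 1; omega
  simp only [gaussBinom_eq_div]
  rw [prod_range_succ' (fun i => 1 - q ^ (n + 1 - i)), prod_range_succ (fun i => 1 - q ^ (n - i)),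
    prod_range_succ (fun i => 1 - q ^ (i + 1))]
  simp only [Nat.add_sub_add_right, Nat.sub_zero]
  rw [hpow]
  field_simp
  ring

/-- The `q`-binomial theorem. -/
theorem prod_add_mul_pow_eq_sum_gaussBinom {q : ℝ} (hq0 : 0 ≤ q) (hq1 : q < 1) (a b : ℝ) (n : ℕ) :
    ∏ j ∈ range n, (a + b * q ^ j) =
      ∑ r ∈ range (n + 1),
        q ^ (r * (r - 1) / 2) * gaussBinom q n r * a ^ (n - r) * b ^ r := by
  induction n with
  | zero => simp [gaussBinom_zero_right]
  | succ n ih =>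
    have htop : ∑ r ∈ range (n + 1),
        q ^ (r * (r - 1) / 2) * gaussBinom q n r * a ^ (n - r) * b ^ r * a =
        ∑ r ∈ range (n + 1), q ^ ((r + 1) * r / 2) * gaussBinom q n (r + 1) *
          a ^ (n - r) * b ^ (r + 1) + a ^ (n + 1) := by
      rw [sum_range_succ', sum_range_succ _ n, gaussBinom_of_lt q n.lt_succ_self]
      simp only [gaussBinom_zero_right, mul_zero, zero_mul, add_zero]
      congr 1
      · refine sum_congr rfl fun r hr => ?_
        have : n - r = n - (r + 1) + 1 := by have := mem_range.1 hr; omega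
        rw [this, pow_succ]
        simp only [Nat.add_sub_cancel]
        ring
      · simp [pow_succ]
    rw [prod_range_succ, ih, mul_add, sum_mul, htop, sum_mul, sum_range_succ' _ (n + 1),
      add_right_comm, ← sum_add_distrib]
    congr 1
    · refine sum_congr rfl fun r hr => ?_
      have hrn : r ≤ n := Nat.lt_succ_iff.1 (mem_range.1 hr)
      have htri : (r + 1) * r / 2 = r * (r - 1) / 2 + r := by
        simpa [sum_range_succ, sum_range_id] using (sum_range_id (r + 1)).symm
      have hpow : q ^ n = q ^ (n - r) * q ^ r := by rw [← pow_add, Nat.sub_add_cancel hrn]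
      rw [gaussBinom_succ_succ hq0 hq1 hrn, Nat.add_sub_cancel, Nat.add_sub_add_right, htri, hpow]
      ring
    · simp [gaussBinom_zero_right]

theorem abs_prod_add_mul_pow_le {q : ℝ} (hq0 : 0 ≤ q) (hq1 : q ≤ 1) (a b : ℝ) (n : ℕ) :
    |∏ j ∈ range n, (a + b * q ^ j)| ≤ (|a| + |b|) ^ n := by
  rw [abs_prod]
  refine (prod_le_prod (fun j _ => abs_nonneg _) (g := fun _ => |a| + |b|) fun j _ => ?_).trans_eq
    (by simp)
  refine (abs_add_le _ _).trans ?_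
  rw [abs_mul, abs_of_nonneg (pow_nonneg hq0 j)]
  gcongr
  exact mul_le_of_le_one_right (abs_nonneg b) (pow_le_one₀ hq0 hq1)

theorem hasDerivAt_sum_pow_div_factorial (n : ℕ) (t : ℝ) :
    HasDerivAt (fun t : ℝ => ∑ k ∈ range (n + 1), t ^ k / (Nat.factorial k : ℝ))
      (∑ k ∈ range n, t ^ k / (Nat.factorial k : ℝ)) t := by
  induction n with
  | zero => simpa using hasDerivAt_const t (1 : ℝ)
  | succ n ih =>
    simp only [sum_range_succ _ (n + 1)]
    rw [sum_range_succ _ n]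
    refine ih.fun_add (((hasDerivAt_pow (n + 1) t).div_const _).congr_deriv ?_)
    rw [Nat.factorial_succ, Nat.add_sub_cancel]
    push_cast
    field_simp

theorem integral_exp_neg_mul_pow_div_factorial (n : ℕ) (x : ℝ) :
    ∫ t in (0:ℝ)..x, Real.exp (-t) * (t ^ n / (Nat.factorial n : ℝ)) =
      1 - Real.exp (-x) * ∑ k ∈ range (n + 1), x ^ k / (Nat.factorial k : ℝ) := by
  have hderiv : ∀ t ∈ Set.uIcc 0 x, HasDerivAt
      (fun t : ℝ => -(Real.exp (-t) * ∑ k ∈ range (n + 1), t ^ k / (Nat.factorial k : ℝ)))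
      (Real.exp (-t) * (t ^ n / (Nat.factorial n : ℝ))) t := fun t _ => by
    refine (((hasDerivAt_neg t).exp.mul
      (hasDerivAt_sum_pow_div_factorial n t)).neg).congr_deriv ?_
    rw [sum_range_succ]
    ring
  rw [intervalIntegral.integral_eq_sub_of_hasDerivAt hderiv
    (Continuous.intervalIntegrable (by fun_prop) _ _), sum_range_succ' _ n]
  simp [sum_range_succ' _ n]
  ring

theorem exp_neg_mul_pow_div_factorial_le_one {t : ℝ} (ht : 0 ≤ t) (n : ℕ) :
    Real.exp (-t) * (t ^ n / (Nat.factorial n : ℝ)) ≤ 1 := by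
  rw [Real.exp_neg, inv_mul_le_one₀ (Real.exp_pos t)]
  exact Real.pow_div_factorial_le_exp t ht n

/-- For `|a| + |b| < 1` and `x ≥ 0`,
`∫_0^x e^{-t} R(a,b,q,t) dt
  = 1 + ∑_{n≥1} ∑_{r=0}^n q^{r(r-1)/2} (n r)_q a^{n-r} bʳ
    - e^{-x} (1 + ∑_{n≥1} ∑_{k=0}^{n} ∑_{r=0}^{n} q^{r(r-1)/2} (n r)_q a^{n-r} bʳ x^k/k!)`,
both series on the right (indexed below by `n+1`) being convergent. -/
theorem stmt_8 (q a b : ℝ) (hq0 : 0 < q) (hq1 : q < 1) (hab : |a| + |b| < 1)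
    (x : ℝ) (hx : 0 ≤ x) :
    Summable (fun n : ℕ =>
      ∑ r ∈ Finset.range (n + 2),
        q ^ (r * (r - 1) / 2) * gaussBinom q (n + 1) r * a ^ (n + 1 - r) * b ^ r) ∧
    Summable (fun n : ℕ =>
      ∑ k ∈ Finset.range (n + 2), ∑ r ∈ Finset.range (n + 2),
        q ^ (r * (r - 1) / 2) * gaussBinom q (n + 1) r * a ^ (n + 1 - r) * b ^ r *
          (x ^ k / (Nat.factorial k : ℝ))) ∧
    ∫ t in (0:ℝ)..x, Real.exp (-t) * ramanujanR a b q t =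
      1 + (∑' n : ℕ,
          ∑ r ∈ Finset.range (n + 2),
            q ^ (r * (r - 1) / 2) * gaussBinom q (n + 1) r * a ^ (n + 1 - r) * b ^ r)
        - Real.exp (-x) *
            (1 + ∑' n : ℕ,
              ∑ k ∈ Finset.range (n + 2), ∑ r ∈ Finset.range (n + 2),
                q ^ (r * (r - 1) / 2) * gaussBinom q (n + 1) r * a ^ (n + 1 - r) * b ^ r *
                  (x ^ k / (Nat.factorial k : ℝ))) := by
  set p : ℕ → ℝ := fun n => ∏ j ∈ range n, (a + b * q ^ j) with hp
  set S : ℕ → ℝ := fun n => ∑ k ∈ range (n + 1), x ^ k / (Nat.factorial k : ℝ) with hS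
  have hsum (n : ℕ) : ∑ r ∈ range (n + 2),
      q ^ (r * (r - 1) / 2) * gaussBinom q (n + 1) r * a ^ (n + 1 - r) * b ^ r = p (n + 1) :=
    (prod_add_mul_pow_eq_sum_gaussBinom hq0.le hq1 a b (n + 1)).symm
  have hsum' (n : ℕ) : ∑ k ∈ range (n + 2), ∑ r ∈ range (n + 2),
      q ^ (r * (r - 1) / 2) * gaussBinom q (n + 1) r * a ^ (n + 1 - r) * b ^ r *
        (x ^ k / (Nat.factorial k : ℝ)) = p (n + 1) * S (n + 1) := by
    simp only [← sum_mul, hsum, ← mul_sum, hS]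
  simp only [hsum, hsum']
  have hple (n : ℕ) : |p n| ≤ (|a| + |b|) ^ n := abs_prod_add_mul_pow_le hq0.le hq1.le a b n
  have hgeom : Summable fun n : ℕ => (|a| + |b|) ^ n :=
    summable_geometric_of_lt_one (by positivity) hab
  have hpsum : Summable p := .of_norm_bounded hgeom hple
  have hpSsum : Summable fun n => p n * S n := by
    refine .of_norm_bounded (hgeom.mul_right (Real.exp x)) fun n => ?_
    have hS0 : 0 ≤ S n := sum_nonneg fun k _ => by positivity
    rw [Real.norm_eq_abs, abs_mul, abs_of_nonneg hS0]
    exact mul_le_mul (hple n) (Real.sum_le_exp_of_nonneg hx _) hS0 (by positivity)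
  refine ⟨(summable_nat_add_iff 1).2 hpsum,
    (summable_nat_add_iff (f := fun n => p n * S n) 1).2 hpSsum, ?_⟩
  have hbound {t : ℝ} (ht : 0 ≤ t) (n : ℕ) :
      ‖p n * (Real.exp (-t) * (t ^ n / (Nat.factorial n : ℝ)))‖ ≤ (|a| + |b|) ^ n := by
    rw [Real.norm_eq_abs, abs_mul, abs_of_nonneg (a := Real.exp (-t) * _) (by positivity)]
    exact (mul_le_of_le_one_right (abs_nonneg _)
      (exp_neg_mul_pow_div_factorial_le_one ht n)).trans (hple n)
  have hpos {t : ℝ} (ht : t ∈ Set.uIoc 0 x) : 0 ≤ t := by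
    rw [Set.uIoc_of_le hx] at ht
    exact ht.1.le
  have hasSum_int : HasSum
      (fun n => ∫ t in (0:ℝ)..x, p n * (Real.exp (-t) * (t ^ n / (Nat.factorial n : ℝ))))
      (∫ t in (0:ℝ)..x, Real.exp (-t) * ramanujanR a b q t) := by
    refine intervalIntegral.hasSum_integral_of_dominated_convergence
      (fun n _ => (|a| + |b|) ^ n)
      (fun n => Continuous.aestronglyMeasurable (by fun_prop))
      (fun n => .of_forall fun t ht => hbound (hpos ht) n)
      (.of_forall fun t _ => hgeom) intervalIntegrable_const
      (.of_forall fun t ht => ?_)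
    have hterms : Summable fun n => p n * (Real.exp (-t) * (t ^ n / (Nat.factorial n : ℝ))) :=
      .of_norm_bounded hgeom (hbound (hpos ht))
    have htsum : Real.exp (-t) * ramanujanR a b q t =
        ∑' n, p n * (Real.exp (-t) * (t ^ n / (Nat.factorial n : ℝ))) := by
      rw [ramanujanR, ← tsum_mul_left]
      exact tsum_congr fun n => by ring
    exact htsum ▸ hterms.hasSum
  simp only [intervalIntegral.integral_const_mul, integral_exp_neg_mul_pow_div_factorial] at hasSum_int
  have hsplit : HasSum (fun n => p n * (1 - Real.exp (-x) * S n))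
      ((∑' n, p n) - Real.exp (-x) * ∑' n, p n * S n) := by
    refine (hpsum.hasSum.sub (hpSsum.hasSum.mul_left (Real.exp (-x)))).congr_fun fun n => ?_
    ring
  rw [hasSum_int.unique hsplit, hpsum.tsum_eq_zero_add, hpSsum.tsum_eq_zero_add]
  simp [hp, hS]
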